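/- arXiv:2402.02451 — 2 statements merged into one kernel-verified Lean document; each statement's English description precedes it below -/
import Mathlib

section
/- Let u : ℝ³ → ℝ be smooth (not necessarily axisymmetric). Then for every x ∈ U: (i) ∇³u(x)[e_r(x),e_θ(x),e_θ(x)] = ∂_r((1/r)∂_r u)(x) + (1/r(x)²)∂_θ(∂_θ∂_r u − (2/r)∂_θ u)(x); (ii) ∇³u(x)[e_θ(x),e_θ(x),e_z] = ∂_z((1/r)∂_r u)(x) + (1/r(x)²)∂_θ²∂_z u(x). -/
open MeasureTheory

noncomputable section

abbrev R3 : Type := Fin 3 → ℝ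

/-- cylindrical radius `r(x) = √(x₁² + x₂²)` -/
def rr (x : R3) : ℝ := Real.sqrt (x 0 ^ 2 + x 1 ^ 2)

/-- the region off the symmetry axis -/
def U : Set R3 := {x | 0 < rr x}

/-- partial derivative in coordinate direction `i` -/
def pd (i : Fin 3) (u : R3 → ℝ) : R3 → ℝ := fun x => fderiv ℝ u x (Pi.single i 1)

/-- angular derivative `∂_θ u = x₁ ∂₂ u − x₂ ∂₁ u` -/
def dTheta (u : R3 → ℝ) : R3 → ℝ := fun x => x 0 * pd 1 u x - x 1 * pd 0 u x

/-- radial derivative `∂_r u = (x₁ ∂₁ u + x₂ ∂₂ u)/r` -/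
def dR (u : R3 → ℝ) : R3 → ℝ := fun x => (x 0 * pd 0 u x + x 1 * pd 1 u x) / rr x

/-- vertical derivative `∂_z` -/
def dZ (u : R3 → ℝ) : R3 → ℝ := pd 2 u

/-- the operator `(1/r)∂_r` -/
def dRr (u : R3 → ℝ) : R3 → ℝ := fun x => dR u x / rr x

/-- axisymmetric: `∂_θ f = 0` on `U` -/
def axisym (f : R3 → ℝ) : Prop := ∀ x ∈ U, dTheta f x = 0

/-- radial unit vector -/
def er (x : R3) : R3 := ![x 0 / rr x, x 1 / rr x, 0]
/-- azimuthal unit vector -/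
def etheta (x : R3) : R3 := ![-(x 1) / rr x, x 0 / rr x, 0]
/-- vertical unit vector -/
def ez : R3 := ![0, 0, 1]

lemma smooth_pd (i : Fin 3) {u : R3 → ℝ} (hu : ContDiff ℝ (⊤ : ℕ∞) u) :
    ContDiff ℝ (⊤ : ℕ∞) (pd i u) := by
  unfold pd
  exact (hu.fderiv_right (m := (⊤ : ℕ∞)) (by norm_cast)).clm_apply contDiff_const

lemma smooth_diff {u : R3 → ℝ} (hu : ContDiff ℝ (⊤ : ℕ∞) u) : Differentiable ℝ u :=
  hu.differentiable (by simp)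

lemma pd_comm (i j : Fin 3) {u : R3 → ℝ} (hu : ContDiff ℝ (⊤ : ℕ∞) u) :
    pd i (pd j u) = pd j (pd i u) := by
  have hd : Differentiable ℝ (fderiv ℝ u) :=
    (hu.fderiv_right (m := (⊤ : ℕ∞)) (by norm_cast)).differentiable (by simp)
  have key : ∀ (i j : Fin 3) (x : R3),
      pd i (pd j u) x = fderiv ℝ (fderiv ℝ u) x (Pi.single i 1) (Pi.single j 1) := by
    intro i j x
    have := (hd x).hasFDerivAt.clm_apply (hasFDerivAt_const (Pi.single j (1:ℝ) : R3) x)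
    unfold pd
    rw [this.fderiv]
    simp
  funext x
  rw [key, key]
  have hs : IsSymmSndFDerivAt ℝ u x := by
    apply ContDiffAt.isSymmSndFDerivAt (n := (⊤ : ℕ∞)) hu.contDiffAt
    simp
    exact WithTop.coe_le_coe.2 (le_top : (2 : ℕ∞) ≤ ⊤)
  exact hs _ _

lemma pd_mul (i : Fin 3) {f g : R3 → ℝ} (hf : ContDiff ℝ (⊤ : ℕ∞) f)
    (hg : ContDiff ℝ (⊤ : ℕ∞) g) :
    pd i (fun y => f y * g y) = fun y => f y * pd i g y + g y * pd i f y := by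
  funext x
  unfold pd
  rw [((smooth_diff hf x).hasFDerivAt.fun_mul (smooth_diff hg x).hasFDerivAt).fderiv]
  simp

lemma pd_add (i : Fin 3) {f g : R3 → ℝ} (hf : ContDiff ℝ (⊤ : ℕ∞) f)
    (hg : ContDiff ℝ (⊤ : ℕ∞) g) :
    pd i (fun y => f y + g y) = fun y => pd i f y + pd i g y := by
  funext x
  unfold pd
  rw [((smooth_diff hf x).hasFDerivAt.fun_add (smooth_diff hg x).hasFDerivAt).fderiv]
  simp

lemma pd_sub (i : Fin 3) {f g : R3 → ℝ} (hf : ContDiff ℝ (⊤ : ℕ∞) f)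
    (hg : ContDiff ℝ (⊤ : ℕ∞) g) :
    pd i (fun y => f y - g y) = fun y => pd i f y - pd i g y := by
  funext x
  unfold pd
  rw [((smooth_diff hf x).hasFDerivAt.fun_sub (smooth_diff hg x).hasFDerivAt).fderiv]
  simp

lemma pd_const (i : Fin 3) (c : ℝ) : pd i (fun _ => c) = fun _ => 0 := by
  funext x
  simp [pd]

lemma pd_coord (i j : Fin 3) : pd i (fun y => y j) = fun _ => if i = j then 1 else 0 := by
  funext x
  unfold pd
  rw [(hasFDerivAt_apply j x).fderiv]
  simp [Pi.single_apply, eq_comm]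

lemma smooth_coord (j : Fin 3) : ContDiff ℝ (⊤ : ℕ∞) (fun y : R3 => y j) := by fun_prop

lemma rr_sq (x : R3) : rr x ^ 2 = x 0 ^ 2 + x 1 ^ 2 := by
  unfold rr
  exact Real.sq_sqrt (by positivity)

lemma U_nhds {x : R3} (hx : x ∈ U) : U ∈ nhds x := by
  have : IsOpen U := by
    unfold U rr
    exact isOpen_lt continuous_const (by fun_prop)
  exact this.mem_nhds hx

/-- The derivative of `rr`. -/
lemma hasFDerivAt_rr {x : R3} (hx : x ∈ U) : ∃ L : R3 →L[ℝ] ℝ, HasFDerivAt rr L x ∧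
    L (Pi.single 0 1) = x 0 / rr x ∧ L (Pi.single 1 1) = x 1 / rr x ∧
    L (Pi.single 2 1) = 0 := by
  have hx0 : 0 < rr x := hx
  have hne : x 0 ^ 2 + x 1 ^ 2 ≠ 0 := by
    rw [← rr_sq]; positivity
  have h := (((hasFDerivAt_apply (𝕜 := ℝ) (0 : Fin 3) x).pow 2).add
    ((hasFDerivAt_apply (𝕜 := ℝ) (1 : Fin 3) x).pow 2)).sqrt hne
  refine ⟨_, h, ?_, ?_, ?_⟩
  all_goals
    simp [rr]
  all_goals
    have : Real.sqrt (x 0 ^ 2 + x 1 ^ 2) ≠ 0 := hx0.ne'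
    field_simp

lemma hasFDerivAt_div_rr {f : R3 → ℝ} {A L : R3 →L[ℝ] ℝ} {x : R3} (hf : HasFDerivAt f A x)
    (hL : HasFDerivAt rr L x) (h0 : rr x ≠ 0) :
    HasFDerivAt (fun y => f y / rr y)
      (f x • ((-(rr x ^ 2)⁻¹) • L) + (rr x)⁻¹ • A) x := by
  have h := hf.fun_mul ((hasDerivAt_inv h0).comp_hasFDerivAt x hL)
  simpa only [div_eq_mul_inv, Function.comp_def] using h

lemma pd_div (i : Fin 3) {f : R3 → ℝ} (hf : ContDiff ℝ (⊤ : ℕ∞) f) {x : R3} (hx : x ∈ U) :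
    pd i (fun y => f y / rr y) x = (pd i f x * rr x - f x * pd i rr x) / rr x ^ 2 := by
  have hx0 : 0 < rr x := hx
  obtain ⟨L, hL, -⟩ := hasFDerivAt_rr hx
  unfold pd
  rw [(hasFDerivAt_div_rr (smooth_diff hf x).hasFDerivAt hL hx0.ne').fderiv, hL.fderiv]
  simp
  field_simp
  ring

lemma pd_div2 (i : Fin 3) {f : R3 → ℝ} (hf : ContDiff ℝ (⊤ : ℕ∞) f) {x : R3} (hx : x ∈ U) :
    pd i (fun y => f y / rr y / rr y) x
      = pd i f x / rr x ^ 2 - 2 * f x * pd i rr x / rr x ^ 3 := by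
  have hx0 : 0 < rr x := hx
  obtain ⟨L, hL, -⟩ := hasFDerivAt_rr hx
  unfold pd
  rw [(hasFDerivAt_div_rr (hasFDerivAt_div_rr (smooth_diff hf x).hasFDerivAt hL hx0.ne')
    hL hx0.ne').fderiv, hL.fderiv]
  simp
  field_simp
  ring

lemma pd_rr {x : R3} (hx : x ∈ U) : pd 0 rr x = x 0 / rr x ∧ pd 1 rr x = x 1 / rr x ∧
    pd 2 rr x = 0 := by
  obtain ⟨L, hL, h⟩ := hasFDerivAt_rr hx
  unfold pd
  rwa [hL.fderiv]

lemma dTheta_div {f : R3 → ℝ} (hf : ContDiff ℝ (⊤ : ℕ∞) f) {x : R3} (hx : x ∈ U) :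
    dTheta (fun y => f y / rr y) x = dTheta f x / rr x := by
  have hx0 : 0 < rr x := hx
  obtain ⟨h0, h1, -⟩ := pd_rr hx
  unfold dTheta
  rw [pd_div 1 hf hx, pd_div 0 hf hx, h0, h1]
  field_simp
  ring

lemma smooth_dTheta {f : R3 → ℝ} (hf : ContDiff ℝ (⊤ : ℕ∞) f) :
    ContDiff ℝ (⊤ : ℕ∞) (dTheta f) :=
  ((smooth_coord 0).mul (smooth_pd 1 hf)).sub ((smooth_coord 1).mul (smooth_pd 0 hf))

lemma dTheta_congr {f g : R3 → ℝ} {x : R3} (hx : x ∈ U) (h : ∀ y ∈ U, f y = g y) :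
    dTheta f x = dTheta g x := by
  have : f =ᶠ[nhds x] g := Filter.eventually_of_mem (U_nhds hx) h
  unfold dTheta pd
  rw [this.fderiv_eq]

lemma fderiv_eq_pd (f : R3 → ℝ) (x v : R3) :
    fderiv ℝ f x v = v 0 * pd 0 f x + v 1 * pd 1 f x + v 2 * pd 2 f x := by
  have : v = v 0 • Pi.single 0 1 + v 1 • Pi.single 1 1 + v 2 • Pi.single 2 1 := by
    ext i; fin_cases i <;> simp
  conv_lhs => rw [this]
  simp only [map_add, map_smul, smul_eq_mul]
  rfl

lemma smooth_dv (v : R3) {f : R3 → ℝ} (hf : ContDiff ℝ (⊤ : ℕ∞) f) :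
    ContDiff ℝ (⊤ : ℕ∞) (fun y => fderiv ℝ f y v) :=
  (hf.fderiv_right (m := (⊤ : ℕ∞)) (by norm_cast)).clm_apply contDiff_const

lemma iter3 {u : R3 → ℝ} (hu : ContDiff ℝ (⊤ : ℕ∞) u) (x a b c : R3) :
    iteratedFDeriv ℝ 3 u x ![a, b, c]
      = fderiv ℝ (fun y => fderiv ℝ (fun z => fderiv ℝ u z c) y b) x a := by
  have h1 : Differentiable ℝ (fderiv ℝ u) :=
    (hu.fderiv_right (m := (⊤ : ℕ∞)) (by norm_cast)).differentiable (by simp)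
  have h2 : Differentiable ℝ (iteratedFDeriv ℝ 2 u) :=
    hu.differentiable_iteratedFDeriv (by norm_cast)
  have e : ∀ y, fderiv ℝ (fun z => fderiv ℝ u z c) y b = iteratedFDeriv ℝ 2 u y ![b, c] := by
    intro y
    rw [iteratedFDeriv_two_apply, ((h1 y).hasFDerivAt.clm_apply (hasFDerivAt_const c y)).fderiv]
    simp
  simp_rw [e]
  rw [iteratedFDeriv_succ_apply_left]
  have h3 := ((ContinuousMultilinearMap.apply ℝ (fun _ : Fin 2 => R3) ℝ ![b, c]).hasFDerivAt.comp x
    (h2 x).hasFDerivAt).fderiv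
  have h4 := congrArg (fun L => L a) h3
  simp only [Function.comp_def, ContinuousMultilinearMap.apply_apply] at h4
  rw [h4]
  rfl

lemma iter3_pd {u : R3 → ℝ} (hu : ContDiff ℝ (⊤ : ℕ∞) u) (x a b c : R3) :
    iteratedFDeriv ℝ 3 u x ![a, b, c]
      = ∑ i, ∑ j, ∑ k, a i * b j * c k * pd i (pd j (pd k u)) x := by
  have hL : ∀ (c : R3) {f : R3 → ℝ} (_ : ContDiff ℝ (⊤ : ℕ∞) f) (i : Fin 3),
      pd i (fun y => fderiv ℝ f y c) =
        fun y => c 0 * pd i (pd 0 f) y + c 1 * pd i (pd 1 f) y + c 2 * pd i (pd 2 f) y := by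
    intro c f hf i
    simp_rw [fderiv_eq_pd]
    have s : ∀ k, ContDiff ℝ (⊤ : ℕ∞) (fun y => c k * pd k f y) := fun k =>
      contDiff_const.mul (smooth_pd k hf)
    rw [pd_add i ((s 0).add (s 1)) (s 2), pd_add i (s 0) (s 1)]
    simp_rw [pd_mul i contDiff_const (smooth_pd _ hf), pd_const]
    simp
  have hM : ∀ (i j : Fin 3), pd i (pd j (fun y => fderiv ℝ u y c)) =
        fun y => c 0 * pd i (pd j (pd 0 u)) y + c 1 * pd i (pd j (pd 1 u)) y
          + c 2 * pd i (pd j (pd 2 u)) y := by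
    intro i j
    have h : (fun y => fderiv ℝ (pd j u) y c) = pd j (fun y => fderiv ℝ u y c) := by
      rw [hL c hu]
      funext y
      rw [fderiv_eq_pd]
      simp only [pd_comm _ j hu]
    rw [← h, hL c (smooth_pd j hu)]
    simp only [pd_comm _ j hu]
  rw [iter3 hu, fderiv_eq_pd]
  simp only [hL b (smooth_dv c hu), hM, Fin.sum_univ_three]
  ring

/-- third-order derivative tensor components of a smooth
(not necessarily axisymmetric) function in the cylindrical frame. -/
theorem stmt_7 (u : R3 → ℝ) (hu : ContDiff ℝ (⊤ : ℕ∞) u) (x : R3) (hx : x ∈ U) :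
    iteratedFDeriv ℝ 3 u x ![er x, etheta x, etheta x]
      = dR (dRr u) x
        + dTheta (fun y => dTheta (dR u) y - 2 * dTheta u y / rr y) x / rr x ^ 2 ∧
    iteratedFDeriv ℝ 3 u x ![etheta x, etheta x, ez]
      = dZ (dRr u) x + dTheta (dTheta (dZ u)) x / rr x ^ 2 := by
  have hx0 : 0 < rr x := hx
  obtain ⟨r0, r1, r2⟩ := pd_rr hx
  have s1 := fun i => smooth_pd i hu
  have s2 := fun i j => smooth_pd i (s1 j)
  have c0 := smooth_coord 0
  have c1 := smooth_coord 1
  set g : R3 → ℝ := fun y => y 0 * pd 0 u y + y 1 * pd 1 u y with hg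
  have sg : ContDiff ℝ (⊤ : ℕ∞) g := (c0.mul (s1 0)).add (c1.mul (s1 1))
  -- derivatives of smooth expressions
  have T1 : ∀ {f : R3 → ℝ} (_ : ContDiff ℝ (⊤ : ℕ∞) f) (i : Fin 3), pd i (dTheta f) =
      fun y => y 0 * pd i (pd 1 f) y + pd 1 f y * (if i = 0 then 1 else 0)
        - (y 1 * pd i (pd 0 f) y + pd 0 f y * (if i = 1 then 1 else 0)) := by
    intro f hf i
    unfold dTheta
    rw [pd_sub i (c0.mul (smooth_pd 1 hf)) (c1.mul (smooth_pd 0 hf)),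
      pd_mul i c0 (smooth_pd 1 hf), pd_mul i c1 (smooth_pd 0 hf), pd_coord, pd_coord]
  have G1 : ∀ i : Fin 3, pd i g =
      fun y => y 0 * pd i (pd 0 u) y + pd 0 u y * (if i = 0 then 1 else 0)
        + (y 1 * pd i (pd 1 u) y + pd 1 u y * (if i = 1 then 1 else 0)) := by
    intro i
    rw [hg, pd_add i (c0.mul (s1 0)) (c1.mul (s1 1)),
      pd_mul i c0 (s1 0), pd_mul i c1 (s1 1), pd_coord, pd_coord]
  have G2 : ∀ i j : Fin 3, pd j (pd i g) =
      fun y => y 0 * pd j (pd i (pd 0 u)) y + pd i (pd 0 u) y * (if j = 0 then 1 else 0)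
        + pd j (pd 0 u) y * (if i = 0 then 1 else 0)
        + (y 1 * pd j (pd i (pd 1 u)) y + pd i (pd 1 u) y * (if j = 1 then 1 else 0)
        + pd j (pd 1 u) y * (if i = 1 then 1 else 0)) := by
    intro i j
    have t0 := (s1 0).mul (contDiff_const (c := (if i = 0 then (1:ℝ) else 0)))
    have t1 := (s1 1).mul (contDiff_const (c := (if i = 1 then (1:ℝ) else 0)))
    have p0 := c0.mul (s2 i 0)
    have p1 := c1.mul (s2 i 1)
    rw [G1, pd_add j (p0.add t0) (p1.add t1), pd_add j p0 t0, pd_add j p1 t1,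
      pd_mul j c0 (s2 i 0), pd_mul j c1 (s2 i 1), pd_mul j (s1 0) contDiff_const,
      pd_mul j (s1 1) contDiff_const, pd_coord, pd_coord, pd_const, pd_const]
    funext y
    ring
  have hRr : dRr u = fun y => g y / rr y / rr y := rfl
  have hR : dR u = fun y => g y / rr y := rfl
  have k01 := pd_comm 0 1 hu
  have k02 := pd_comm 0 2 hu
  have k12 := pd_comm 1 2 hu
  have k01' : ∀ k, pd 0 (pd 1 (pd k u)) = pd 1 (pd 0 (pd k u)) := fun k => pd_comm 0 1 (s1 k)
  have k02' : ∀ k, pd 0 (pd 2 (pd k u)) = pd 2 (pd 0 (pd k u)) := fun k => pd_comm 0 2 (s1 k)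
  have k12' : ∀ k, pd 1 (pd 2 (pd k u)) = pd 2 (pd 1 (pd k u)) := fun k => pd_comm 1 2 (s1 k)
  have hsq := rr_sq x
  constructor
  · have E : dTheta (fun y => dTheta (dR u) y - 2 * dTheta u y / rr y) x =
        (dTheta (dTheta g) x - 2 * dTheta (dTheta u) x) / rr x := by
      have sT : ContDiff ℝ (⊤ : ℕ∞) (fun y => 2 * dTheta u y) :=
        contDiff_const.mul (smooth_dTheta hu)
      rw [dTheta_congr (g := fun y => (dTheta g y - 2 * dTheta u y) / rr y) hx,
        dTheta_div ((smooth_dTheta sg).sub sT) hx]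
      · congr 1
        conv_lhs => unfold dTheta
        change x 0 * pd 1 (fun y => dTheta g y - 2 * dTheta u y) x
          - x 1 * pd 0 (fun y => dTheta g y - 2 * dTheta u y) x = _
        rw [pd_sub _ (smooth_dTheta sg) sT, pd_sub _ (smooth_dTheta sg) sT,
          pd_mul _ contDiff_const (smooth_dTheta hu), pd_mul _ contDiff_const (smooth_dTheta hu),
          pd_const, pd_const]
        change _ = (x 0 * pd 1 (dTheta g) x - x 1 * pd 0 (dTheta g) x)
          - 2 * (x 0 * pd 1 (dTheta u) x - x 1 * pd 0 (dTheta u) x)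
        ring
      · intro y hy
        rw [hR, dTheta_div sg hy]
        ring
    rw [E, iter3_pd hu, hRr]
    have E2 : ∀ f : R3 → ℝ, dTheta (dTheta f) x
      = x 0 * pd 1 (dTheta f) x - x 1 * pd 0 (dTheta f) x := fun f => rfl
    rw [E2, E2, T1 sg, T1 sg, T1 hu, T1 hu]
    unfold dR
    rw [pd_div2 0 sg hx, pd_div2 1 sg hx, r0, r1]
    simp only [G2]
    simp only [G1]
    simp only [Fin.sum_univ_three, er, etheta, k01, k01', hg]
    simp
    field_simp
    rw [hsq]
    ring
  · rw [iter3_pd hu, hRr]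
    have E2 : ∀ f : R3 → ℝ, dTheta (dTheta f) x
      = x 0 * pd 1 (dTheta f) x - x 1 * pd 0 (dTheta f) x := fun f => rfl
    unfold dZ
    rw [E2, T1 (s1 2), T1 (s1 2), pd_div2 2 sg hx, r2]
    simp only [G1]
    simp only [Fin.sum_univ_three, ez, etheta, k01, k01', k02, k12, hg]
    simp
    field_simp
    ring
end
end

section
/- For every triple 𝔐=(m_c,m_r,m_z) of nonnegative integers there exist integers C_𝔑, indexed by triples 𝔑=(n_c,n_r,n_z) with 𝔑 ≤ 𝔐 componentwise and 1 ≤ |𝔑| ≤ |𝔐|, such that for all smooth axisymmetric functions f, g : ℝ³ → ℝ the following identity holds on U: 𝒟^𝔐(g·∂_z f) − g·∂_z(𝒟^𝔐 f) = Σ_{1≤|𝔑|≤|𝔐|, 𝔑≤𝔐} C_𝔑 · (𝒟^𝔑 g)·(𝒟^{𝔐−𝔑}∂_z f). -/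
open MeasureTheory

noncomputable section

/-- the compound cylindrical derivative `𝒟^𝔐 = ∂_z^{m_z} ∘ ∂_r^{m_r} ∘ ((1/r)∂_r)^{m_c}` -/
def Dop (mc mr mz : ℕ) (f : R3 → ℝ) : R3 → ℝ := dZ^[mz] (dR^[mr] (dRr^[mc] f))

/-- multi-indices `𝔑 ≤ 𝔐` componentwise with `1 ≤ |𝔑|` (hence `|𝔑| ≤ |𝔐|`) -/
def subIdx (mc mr mz : ℕ) : Finset (ℕ × ℕ × ℕ) :=
  (Finset.range (mc + 1) ×ˢ Finset.range (mr + 1) ×ˢ Finset.range (mz + 1)).filter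
    (fun p => 1 ≤ 2 * p.1 + p.2.1 + p.2.2)

open scoped ContDiff

/-- derivative along a vector field -/
def derV (V : R3 → R3) (u : R3 → ℝ) : R3 → ℝ := fun x => fderiv ℝ u x (V x)

abbrev SmU {F : Type} [NormedAddCommGroup F] [NormedSpace ℝ F] (u : R3 → F) : Prop :=
  ContDiffOn ℝ ∞ u U

lemma rr_cont : Continuous rr := by unfold rr; fun_prop

lemma U_open : IsOpen U := isOpen_lt continuous_const rr_cont

lemma rr_smooth : SmU rr := by
  have h : ContDiffOn ℝ ∞ (fun x : R3 => x 0 ^ 2 + x 1 ^ 2) U := by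
    apply ContDiff.contDiffOn; fun_prop
  refine h.sqrt ?_
  intro x hx h0
  have hx' : 0 < rr x := hx
  simp [rr, h0] at hx'

lemma rr_ne {x : R3} (hx : x ∈ U) : rr x ≠ 0 := ne_of_gt hx

lemma SmU.diffAt {F : Type} [NormedAddCommGroup F] [NormedSpace ℝ F] {u : R3 → F}
    (h : SmU u) {x : R3} (hx : x ∈ U) : DifferentiableAt ℝ u x :=
  (h.contDiffAt (U_open.mem_nhds hx)).differentiableAt (by simp)

lemma SmU.fder {u : R3 → ℝ} (h : SmU u) : SmU (fderiv ℝ u) :=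
  h.fderiv_of_isOpen U_open (by simp)

lemma derV_smooth {V : R3 → R3} (hV : SmU V) {u : R3 → ℝ} (h : SmU u) : SmU (derV V u) :=
  h.fder.clm_apply hV

lemma iter_smooth {V : R3 → R3} (hV : SmU V) {u : R3 → ℝ} (h : SmU u) (n : ℕ) :
    SmU ((derV V)^[n] u) := by
  induction n with
  | zero => exact h
  | succ n ih => rw [Function.iterate_succ_apply']; exact derV_smooth hV ih

lemma derV_congr (V : R3 → R3) {u v : R3 → ℝ} (h : Set.EqOn u v U) :
    Set.EqOn (derV V u) (derV V v) U := by
  intro x hx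
  have : u =ᶠ[nhds x] v := Filter.eventuallyEq_of_mem (U_open.mem_nhds hx) h
  simp only [derV, this.fderiv_eq]

lemma iter_congr (V : R3 → R3) {u v : R3 → ℝ} (h : Set.EqOn u v U) (n : ℕ) :
    Set.EqOn ((derV V)^[n] u) ((derV V)^[n] v) U := by
  induction n with
  | zero => exact h
  | succ n ih => rw [Function.iterate_succ_apply', Function.iterate_succ_apply']
                 exact derV_congr V ih

lemma derV_sum {ι : Type} (V : R3 → R3) (s : Finset ι) (c : ι → ℝ) (w : ι → R3 → ℝ)
    (hw : ∀ i ∈ s, SmU (w i)) :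
    Set.EqOn (derV V (fun x => ∑ i ∈ s, c i * w i x)) (fun x => ∑ i ∈ s, c i * derV V (w i) x) U := by
  intro x hx
  have : HasFDerivAt (fun x => ∑ i ∈ s, c i * w i x) (∑ i ∈ s, c i • fderiv ℝ (w i) x) x :=
    HasFDerivAt.fun_sum fun i hi => ((hw i hi).diffAt hx).hasFDerivAt.const_mul (c i)
  simp only [derV, this.fderiv]
  simp

lemma iter_sum {ι : Type} {V : R3 → R3} (hV : SmU V) (s : Finset ι) (c : ι → ℝ)
    (w : ι → R3 → ℝ) (hw : ∀ i ∈ s, SmU (w i)) (n : ℕ) :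
    Set.EqOn ((derV V)^[n] (fun x => ∑ i ∈ s, c i * w i x))
      (fun x => ∑ i ∈ s, c i * (derV V)^[n] (w i) x) U := by
  induction n with
  | zero => intro x _; rfl
  | succ n ih =>
    intro x hx
    simp only [Function.iterate_succ_apply']
    rw [derV_congr V ih hx, derV_sum V s c _ (fun i hi => iter_smooth hV (hw i hi) n) hx]

lemma derV_mul (V : R3 → R3) {u v : R3 → ℝ} (hu : SmU u) (hv : SmU v) {x : R3} (hx : x ∈ U) :
    derV V (fun y => u y * v y) x = derV V u x * v x + u x * derV V v x := by
  have := (hu.diffAt hx).hasFDerivAt.mul (hv.diffAt hx).hasFDerivAt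
  have h2 : fderiv ℝ (fun y => u y * v y) x = _ := this.fderiv
  simp only [derV, h2]
  simp
  ring

lemma iter_mul {V : R3 → R3} (hV : SmU V) {u v : R3 → ℝ} (hu : SmU u) (hv : SmU v) (n : ℕ) :
    Set.EqOn ((derV V)^[n] (fun y => u y * v y))
      (fun x => ∑ p ∈ Finset.HasAntidiagonal.antidiagonal n,
        (n.choose p.1 : ℝ) * ((derV V)^[p.1] u x * (derV V)^[p.2] v x)) U := by
  induction n with
  | zero => intro x _; simp
  | succ n ih =>
    intro x hx
    rw [Function.iterate_succ_apply', derV_congr V ih hx,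
      derV_sum V _ _ (fun (p : ℕ × ℕ) x => (derV V)^[p.1] u x * (derV V)^[p.2] v x)
        (fun i _ => (iter_smooth hV hu _).mul (iter_smooth hV hv _)) hx]
    dsimp only
    rw [Finset.sum_antidiagonal_choose_succ_mul
      (fun i j => (derV V)^[i] u x * (derV V)^[j] v x) n, ← Finset.sum_add_distrib]
    refine Finset.sum_congr rfl fun p hp => ?_
    rw [derV_mul V (iter_smooth hV hu _) (iter_smooth hV hv _) hx,
      Function.iterate_succ_apply', Function.iterate_succ_apply']
    have : n.choose p.2 = n.choose p.1 :=
      (Nat.choose_symm_of_eq_add (Finset.HasAntidiagonal.mem_antidiagonal.1 hp).symm).symm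
    rw [this]; ring

lemma iter_mul' {V : R3 → R3} (hV : SmU V) {u v : R3 → ℝ} (hu : SmU u) (hv : SmU v) (n : ℕ) :
    Set.EqOn ((derV V)^[n] (fun y => u y * v y))
      (fun x => ∑ k ∈ Finset.range (n + 1),
        (n.choose k : ℝ) * ((derV V)^[k] u x * (derV V)^[n - k] v x)) U := by
  intro x hx
  rw [iter_mul hV hu hv n hx]
  exact Finset.Nat.sum_antidiagonal_eq_sum_range_succ_mk _ n

lemma triple_mul {A B C : R3 → R3} (hA : SmU A) (hB : SmU B) (hC : SmU C) {u v : R3 → ℝ}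
    (hu : SmU u) (hv : SmU v) (a b c : ℕ) {x : R3} (hx : x ∈ U) :
    (derV C)^[c] ((derV B)^[b] ((derV A)^[a] (fun y => u y * v y))) x =
      ∑ i ∈ Finset.range (a + 1), ∑ j ∈ Finset.range (b + 1), ∑ k ∈ Finset.range (c + 1),
        (a.choose i : ℝ) * ((b.choose j : ℝ) * ((c.choose k : ℝ) *
          ((derV C)^[k] ((derV B)^[j] ((derV A)^[i] u)) x *
           (derV C)^[c - k] ((derV B)^[b - j] ((derV A)^[a - i] v)) x))) := by
  have sA := fun n => iter_smooth hA hu n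
  have sA' := fun n => iter_smooth hA hv n
  have sB := fun m n => iter_smooth hB (sA n) m
  have sB' := fun m n => iter_smooth hB (sA' n) m
  rw [iter_congr C (iter_congr B (iter_mul' hA hu hv a) b) c hx]
  rw [iter_congr C (iter_sum hB _ _ (fun i x => (derV A)^[i] u x * (derV A)^[a - i] v x)
    (fun i _ => (sA i).mul (sA' (a - i))) b) c hx]
  rw [iter_sum hC _ _ (fun i => (derV B)^[b] (fun x => (derV A)^[i] u x * (derV A)^[a - i] v x))
    (fun i _ => iter_smooth hB ((sA i).mul (sA' (a - i))) b) c hx]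
  dsimp only
  refine Finset.sum_congr rfl fun i _ => ?_
  rw [iter_congr C (iter_mul' hB (sA i) (sA' (a - i)) b) c hx]
  rw [iter_sum hC _ _ (fun j x => (derV B)^[j] ((derV A)^[i] u) x *
      (derV B)^[b - j] ((derV A)^[a - i] v) x)
    (fun j _ => (sB j i).mul (sB' (b - j) (a - i))) c hx]
  dsimp only
  rw [Finset.mul_sum]
  refine Finset.sum_congr rfl fun j _ => ?_
  rw [iter_mul' hC (sB j i) (sB' (b - j) (a - i)) c hx]
  simp only [Finset.mul_sum]

/-- the vertical direction -/
def e2 : R3 := Pi.single 2 1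

lemma derV_comm {V : R3 → R3} (hV : SmU V) (hinv : ∀ x : R3, ∀ t : ℝ, V (x + t • e2) = V x)
    {u : R3 → ℝ} (hu : SmU u) :
    Set.EqOn (derV (fun _ => e2) (derV V u)) (derV V (derV (fun _ => e2) u)) U := by
  intro x hx
  have h1 := (hu.fder.diffAt hx).hasFDerivAt.clm_apply (hV.diffAt hx).hasFDerivAt
  have h2 := (hu.fder.diffAt hx).hasFDerivAt.clm_apply (hasFDerivAt_const e2 x)
  have h1' : fderiv ℝ (derV V u) x = _ := h1.fderiv
  have h2' : fderiv ℝ (derV (fun _ => e2) u) x = _ := h2.fderiv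
  have hz : fderiv ℝ V x e2 = 0 := by
    rw [← (hV.diffAt hx).lineDeriv_eq_fderiv]
    simp [lineDeriv, hinv]
  have hs : IsSymmSndFDerivAt ℝ u x :=
    (hu.contDiffAt (U_open.mem_nhds hx)).isSymmSndFDerivAt (by simp; exact WithTop.coe_le_coe.2 (le_top : (2 : ℕ∞) ≤ ⊤))
  rw [derV, derV, h1', h2']
  simp [hz]
  exact hs _ _

lemma iter_comm {V : R3 → R3} (hV : SmU V) (hinv : ∀ x : R3, ∀ t : ℝ, V (x + t • e2) = V x)
    {u : R3 → ℝ} (hu : SmU u) (n : ℕ) :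
    Set.EqOn (derV (fun _ => e2) ((derV V)^[n] u)) ((derV V)^[n] (derV (fun _ => e2) u)) U := by
  induction n with
  | zero => intro x _; rfl
  | succ n ih =>
    intro x hx
    rw [Function.iterate_succ_apply', Function.iterate_succ_apply',
      derV_comm hV hinv (iter_smooth hV hu n) hx, derV_congr V ih hx]

def VR : R3 → R3 := fun x =>
  (x 0 / rr x) • (Pi.single 0 1 : R3) + (x 1 / rr x) • (Pi.single 1 1 : R3)
def VC : R3 → R3 := fun x =>
  (x 0 / rr x / rr x) • (Pi.single 0 1 : R3) + (x 1 / rr x / rr x) • (Pi.single 1 1 : R3)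

lemma co_smooth (i : Fin 3) : SmU (fun x : R3 => x i) := by
  apply ContDiff.contDiffOn; fun_prop

lemma VR_smooth : SmU VR :=
  (((co_smooth 0).div rr_smooth fun _ h => rr_ne h).smul contDiffOn_const).add
    (((co_smooth 1).div rr_smooth fun _ h => rr_ne h).smul contDiffOn_const)

lemma VC_smooth : SmU VC :=
  ((((co_smooth 0).div rr_smooth fun _ h => rr_ne h).div rr_smooth
      fun _ h => rr_ne h).smul contDiffOn_const).add
    ((((co_smooth 1).div rr_smooth fun _ h => rr_ne h).div rr_smooth
      fun _ h => rr_ne h).smul contDiffOn_const)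

lemma VR_inv (x : R3) (t : ℝ) : VR (x + t • e2) = VR x := by
  simp [VR, rr, e2]

lemma VC_inv (x : R3) (t : ℝ) : VC (x + t • e2) = VC x := by
  simp [VC, rr, e2]

lemma dR_eq : dR = derV VR := by
  funext u x
  simp only [dR, derV, VR, pd, map_add, map_smul, smul_eq_mul]
  ring

lemma dRr_eq : dRr = derV VC := by
  funext u x
  simp only [dRr, dR, derV, VC, pd, map_add, map_smul, smul_eq_mul]
  ring

lemma dZ_eq : dZ = derV (fun _ => e2) := rfl

/-- the commutator `[𝒟^𝔐, g∂_z]f` expands with integer coefficients as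
`Σ_{1≤|𝔑|≤|𝔐|, 𝔑≤𝔐} C_𝔑 (𝒟^𝔑 g)(𝒟^{𝔐−𝔑}∂_z f)` for all smooth axisymmetric `f, g`. -/
theorem stmt_10 (mc mr mz : ℕ) :
    ∃ C : ℕ × ℕ × ℕ → ℤ,
      ∀ f g : R3 → ℝ, ContDiff ℝ (⊤ : ℕ∞) f → axisym f →
        ContDiff ℝ (⊤ : ℕ∞) g → axisym g → ∀ x ∈ U,
          Dop mc mr mz (fun y => g y * dZ f y) x - g x * dZ (Dop mc mr mz f) x
            = ∑ p ∈ subIdx mc mr mz,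
                (C p : ℝ) * Dop p.1 p.2.1 p.2.2 g x
                  * Dop (mc - p.1) (mr - p.2.1) (mz - p.2.2) (dZ f) x := by
  refine ⟨fun p => (mc.choose p.1 * mr.choose p.2.1 * mz.choose p.2.2 : ℕ), ?_⟩
  intro f g hf _ hg _ x hx
  have hf' : SmU f := hf.contDiffOn
  have hg' : SmU g := hg.contDiffOn
  have hE : SmU (fun _ : R3 => e2) := contDiffOn_const
  have hz : SmU (dZ f) := derV_smooth hE hf'
  have hcomm : dZ (Dop mc mr mz f) x = Dop mc mr mz (dZ f) x := by
    simp only [Dop, dR_eq, dRr_eq, dZ_eq]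
    rw [← Function.iterate_succ_apply' (derV fun _ => e2), Function.iterate_succ_apply]
    have sA := iter_smooth VC_smooth hf' mc
    rw [iter_congr _ (iter_comm VR_smooth VR_inv sA mr) mz hx]
    exact iter_congr _ (iter_congr _ (iter_comm VC_smooth VC_inv hf' mc) mr) mz hx
  have hmul : Dop mc mr mz (fun y => g y * dZ f y) x = 
      ∑ p ∈ Finset.range (mc + 1) ×ˢ Finset.range (mr + 1) ×ˢ Finset.range (mz + 1),
        (((mc.choose p.1 * mr.choose p.2.1 * mz.choose p.2.2 : ℕ) : ℤ) : ℝ)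
          * Dop p.1 p.2.1 p.2.2 g x
          * Dop (mc - p.1) (mr - p.2.1) (mz - p.2.2) (dZ f) x := by
    simp only [Finset.sum_product]
    have := triple_mul VC_smooth VR_smooth hE hg' hz mc mr mz hx
    rw [← dR_eq, ← dRr_eq, ← dZ_eq] at this
    refine this.trans ?_
    refine Finset.sum_congr rfl fun i _ => Finset.sum_congr rfl fun j _ =>
      Finset.sum_congr rfl fun k _ => ?_
    simp only [Dop]
    push_cast
    ring
  rw [hmul, hcomm, subIdx, ← Finset.sum_filter_add_sum_filter_not _
    (fun p : ℕ × ℕ × ℕ => 1 ≤ 2 * p.1 + p.2.1 + p.2.2)]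
  have hs : (Finset.range (mc + 1) ×ˢ Finset.range (mr + 1) ×ˢ Finset.range (mz + 1)).filter
      (fun p : ℕ × ℕ × ℕ => ¬ 1 ≤ 2 * p.1 + p.2.1 + p.2.2) = {(0, 0, 0)} := by
    ext ⟨a, b, c⟩
    simp only [Finset.mem_filter, Finset.mem_product, Finset.mem_range, Finset.mem_singleton,
      Prod.mk.injEq]
    omega
  rw [hs, Finset.sum_singleton]
  simp [Dop]
end
end
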